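/- Let γ be a monotonicity-preserving specification. Then for each finite Λ the limits γ^(±)_Λ(·|ω) = lim_{S↑𝕃} γ_Λ(·|ω_S ±_{Sᶜ}) exist for every ω and define two monotonicity-preserving specifications γ^(+) and γ^(−), with γ^(+) right continuous and γ^(−) left continuous; they are translation invariant if γ is; γ^(−)_Λ(f) ≤ γ_Λ(f) ≤ γ^(+)_Λ(f) pointwise for every increasing local f; and all three specifications γ^(+), γ^(−), γ are continuous (i.e. each π_Λ f with f local is continuous) at every configuration of the set Ω_± = {ω ∈ Ω : γ^(+)_Λ(f|ω) = γ^(−)_Λ(f|ω) for all local f and all Λ ∈ 𝒮}. -/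

import Mathlib

open MeasureTheory Filter Topology
open scoped ENNReal MeasureTheory Classical

noncomputable section

/-- The σ-algebra on configuration space generated by the coordinates in `Δ`. -/
def cylinderSigma (Ω₀ : Type*) [MeasurableSpace Ω₀] {ι : Type*} (Δ : Set ι) :
    MeasurableSpace (ι → Ω₀) :=
  MeasurableSpace.comap (fun ω (x : Δ) => ω (x : ι)) MeasurableSpace.pi

/-- The configuration agreeing with `ω` on `S` and with `θ` off `S`. -/
def splice {ι Ω₀ : Type*} (S : Set ι) (ω θ : ι → Ω₀) : ι → Ω₀ :=
  fun x => if x ∈ S then ω x else θ x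

/-- A function is local if it is measurable with respect to a finite cylinder σ-algebra. -/
def IsLocal {ι Ω₀ : Type*} [MeasurableSpace Ω₀] (f : (ι → Ω₀) → ℝ) : Prop :=
  ∃ Δ : Finset ι, Measurable[cylinderSigma Ω₀ (Δ : Set ι)] f

/-- Quasilocality of `f` in the direction `θ`. -/
def QuasilocalInDir {ι Ω₀ : Type*} (θ : ι → Ω₀) (f : (ι → Ω₀) → ℝ) : Prop :=
  ∀ ω, Tendsto (fun S : Finset ι => f (splice (S : Set ι) ω θ)) atTop (𝓝 (f ω))

/-- `f` is quasilocal: a uniform limit of local functions. -/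
def IsQuasilocal {ι Ω₀ : Type*} [MeasurableSpace Ω₀] (f : (ι → Ω₀) → ℝ) : Prop :=
  ∀ ε : ℝ, 0 < ε → ∃ g, IsLocal g ∧ ∀ ω, |f ω - g ω| ≤ ε

/-- A specification: a proper consistent family of probability kernels indexed by
finite subsets of the site space. -/
structure Specification (ι Ω₀ : Type*) [MeasurableSpace Ω₀] where
  k : Finset ι → (ι → Ω₀) → Measure (ι → Ω₀)
  isProb : ∀ Λ ω, IsProbabilityMeasure (k Λ ω)
  meas : ∀ (Λ : Finset ι) (A : Set (ι → Ω₀)), MeasurableSet A →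
    Measurable[cylinderSigma Ω₀ ((Λ : Set ι))ᶜ] (fun ω => k Λ ω A)
  proper : ∀ (Λ : Finset ι) (B : Set (ι → Ω₀)),
    MeasurableSet[cylinderSigma Ω₀ ((Λ : Set ι))ᶜ] B → ∀ ω, k Λ ω B = B.indicator 1 ω
  consistent : ∀ ⦃Λ Λ' : Finset ι⦄, Λ ⊆ Λ' → ∀ ω, (k Λ' ω).bind (k Λ) = k Λ' ω

/-- `γ_Λ f`, the expectation of `f` under the kernel of the specification. -/
def specInt {ι Ω₀ : Type*} [MeasurableSpace Ω₀] (γ : Specification ι Ω₀)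
    (Λ : Finset ι) (f : (ι → Ω₀) → ℝ) (ω : ι → Ω₀) : ℝ :=
  ∫ x, f x ∂(γ.k Λ ω)

/-- DLR consistency of a measure with a specification. -/
def IsGibbs {ι Ω₀ : Type*} [MeasurableSpace Ω₀] (γ : Specification ι Ω₀)
    (μ : Measure (ι → Ω₀)) : Prop :=
  ∀ Λ, μ.bind (γ.k Λ) = μ

/-- A specification is quasilocal in the direction `θ`. -/
def SpecQuasilocalInDir {ι Ω₀ : Type*} [MeasurableSpace Ω₀] (γ : Specification ι Ω₀)
    (θ : ι → Ω₀) : Prop :=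
  ∀ Λ f, IsLocal f → QuasilocalInDir θ (specInt γ Λ f)

/-- A quasilocal specification. -/
def IsSpecQuasilocal {ι Ω₀ : Type*} [MeasurableSpace Ω₀] (γ : Specification ι Ω₀) : Prop :=
  ∀ Λ f, IsLocal f → IsQuasilocal (specInt γ Λ f)

/-- A monotonicity-preserving specification. -/
def MonoPreserving {ι Ω₀ : Type*} [MeasurableSpace Ω₀] [Preorder Ω₀]
    (γ : Specification ι Ω₀) : Prop :=
  ∀ Λ (f : (ι → Ω₀) → ℝ), Measurable f → Monotone f → Monotone (specInt γ Λ f)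

/-- `γ'` is the limit of `γ` with boundary condition forced to `θ` outside larger
and larger volumes. -/
def IsDirLimitSpec {ι Ω₀ : Type*} [MeasurableSpace Ω₀] (γ γ' : Specification ι Ω₀)
    (θ : ι → Ω₀) : Prop :=
  ∀ Λ f, IsLocal f → ∀ ω,
    Tendsto (fun S : Finset ι => specInt γ Λ f (splice (S : Set ι) ω θ)) atTop
      (𝓝 (specInt γ' Λ f ω))

/-- `μ` is the weak limit `lim_{Λ↑𝕃} γ_Λ(⬝|θ)`. -/
def IsLimitWithBoundary {ι Ω₀ : Type*} [MeasurableSpace Ω₀] (γ : Specification ι Ω₀)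
    (θ : ι → Ω₀) (μ : Measure (ι → Ω₀)) : Prop :=
  IsProbabilityMeasure μ ∧
    ∀ f, IsLocal f → Tendsto (fun Λ : Finset ι => specInt γ Λ f θ) atTop (𝓝 (∫ ω, f ω ∂μ))

/-- The set of configurations at which all the `γ_Λ f` (`f` local) are continuous. -/
def contSet {ι Ω₀ : Type*} [MeasurableSpace Ω₀] [TopologicalSpace Ω₀]
    (γ : Specification ι Ω₀) : Set (ι → Ω₀) :=
  {ω | ∀ Λ f, IsLocal f → ContinuousAt (specInt γ Λ f) ω}

/-- An almost quasilocal probability measure. -/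
def AlmostQuasilocal {ι Ω₀ : Type*} [MeasurableSpace Ω₀] [TopologicalSpace Ω₀]
    (μ : Measure (ι → Ω₀)) : Prop :=
  ∃ γ : Specification ι Ω₀, IsGibbs γ μ ∧ μ (contSet γ) = 1

/-- Sites of the lattice `ℤ^d`. -/
abbrev Site (d : ℕ) := Fin d → ℤ

/-- The cube `Λ_n = ([-n,n] ∩ ℤ)^d`. -/
def cube (d : ℕ) (n : ℕ) : Finset (Site d) :=
  Fintype.piFinset fun _ => Finset.Icc (-(n : ℤ)) (n : ℤ)

/-- Translation of a configuration by `i`. -/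
def shift {Ω₀ : Type*} {d : ℕ} (i : Site d) (ω : Site d → Ω₀) : Site d → Ω₀ :=
  fun x => ω (x - i)

/-- Translation invariance of a measure. -/
def TransInv {Ω₀ : Type*} [MeasurableSpace Ω₀] {d : ℕ} (μ : Measure (Site d → Ω₀)) : Prop :=
  ∀ i : Site d, μ.map (shift i) = μ

/-- Translation invariance of a specification. -/
def TransInvSpec {Ω₀ : Type*} [MeasurableSpace Ω₀] {d : ℕ}
    (γ : Specification (Site d) Ω₀) : Prop :=
  ∀ (i : Site d) (Λ : Finset (Site d)) (ω),
    γ.k (Λ.image (· + i)) (shift i ω) = (γ.k Λ ω).map (shift i)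

/-- Restriction (projection) of a measure to the coordinates in `Δ`. -/
def restrictTo {ι Ω₀ : Type*} [MeasurableSpace Ω₀] (Δ : Finset ι)
    (μ : Measure (ι → Ω₀)) : Measure ({x // x ∈ Δ} → Ω₀) :=
  μ.map (fun ω (x : {x // x ∈ Δ}) => ω (x : ι))

/-- The Radon–Nikodym density `dμ_Δ/dν_Δ`, viewed as a function on configuration space. -/
def density {ι Ω₀ : Type*} [MeasurableSpace Ω₀] (Δ : Finset ι)
    (μ ν : Measure (ι → Ω₀)) : (ι → Ω₀) → ℝ :=
  fun ω => ((restrictTo Δ μ).rnDeriv (restrictTo Δ ν) (fun x : {x // x ∈ Δ} => ω (x : ι))).toReal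

/-- Relative entropy `H_Δ(μ|ν)` at the finite volume `Δ` (`+∞` if `μ_Δ` is not
absolutely continuous with respect to `ν_Δ`). -/
def relEnt {ι Ω₀ : Type*} [MeasurableSpace Ω₀] (Δ : Finset ι)
    (μ ν : Measure (ι → Ω₀)) : ℝ≥0∞ :=
  if restrictTo Δ μ ≪ restrictTo Δ ν then
    ENNReal.ofReal (∫ ω, density Δ μ ν ω * Real.log (density Δ μ ν ω) ∂ν)
  else ⊤

/-- Vanishing relative entropy density: `h(μ|ν) = 0`. -/
def EntDensityZero {Ω₀ : Type*} [MeasurableSpace Ω₀] {d : ℕ}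
    (μ ν : Measure (Site d → Ω₀)) : Prop :=
  Tendsto (fun n => relEnt (cube d n) μ ν / ((cube d n).card : ℝ≥0∞)) atTop (𝓝 0)


/-- The set `Ω_±` of configurations on which the plus- and minus-limit specifications
agree (on all local functions and finite volumes). -/
def agreeSet {ι Ω₀ : Type*} [MeasurableSpace Ω₀] (γp γm : Specification ι Ω₀) :
    Set (ι → Ω₀) :=
  {ω | ∀ Λ f, IsLocal f → specInt γp Λ f ω = specInt γm Λ f ω}

section Helpers

set_option linter.unusedSectionVars false

variable {ι Ω₀ : Type*}

theorem cylinderSigma_le [MeasurableSpace Ω₀] (Δ : Set ι) :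
    cylinderSigma Ω₀ Δ ≤ (MeasurableSpace.pi : MeasurableSpace (ι → Ω₀)) := by
  unfold cylinderSigma
  apply Measurable.comap_le
  fun_prop

theorem mem_of_agree [MeasurableSpace Ω₀] {Δ : Set ι} {B : Set (ι → Ω₀)}
    (hB : MeasurableSet[cylinderSigma Ω₀ Δ] B) {σ τ : ι → Ω₀} (h : ∀ x ∈ Δ, σ x = τ x) :
    σ ∈ B ↔ τ ∈ B := by
  obtain ⟨C, -, rfl⟩ := hB
  have : (fun x : Δ => σ x) = (fun x : Δ => τ x) := by
    funext x; exact h x x.2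
  simp only [Set.mem_preimage, this]

theorem eq_of_agree [MeasurableSpace Ω₀] {Δ : Set ι} {β : Type*} [MeasurableSpace β]
    [MeasurableSingletonClass β] {f : (ι → Ω₀) → β}
    (hf : Measurable[cylinderSigma Ω₀ Δ] f) {σ τ : ι → Ω₀} (h : ∀ x ∈ Δ, σ x = τ x) :
    f σ = f τ := by
  have := (mem_of_agree (hf (measurableSet_singleton (f τ))) h).2 rfl
  exact this

theorem IsLocal.measurable [MeasurableSpace Ω₀] {f : (ι → Ω₀) → ℝ} (hf : IsLocal f) :
    Measurable f := by
  obtain ⟨Δ, h⟩ := hf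
  exact h.mono (cylinderSigma_le _) le_rfl

theorem isLocal_of_agree [Finite Ω₀] [MeasurableSpace Ω₀] [DiscreteMeasurableSpace Ω₀]
    (Δ : Finset ι) {f : (ι → Ω₀) → ℝ} (h : ∀ σ τ, (∀ x ∈ Δ, σ x = τ x) → f σ = f τ) :
    IsLocal f := by
  refine ⟨Δ, ?_⟩
  rcases isEmpty_or_nonempty (ι → Ω₀) with he | ⟨⟨θ⟩⟩
  · intro s _
    rw [Set.eq_empty_of_isEmpty (f ⁻¹' s)]
    exact @MeasurableSet.empty _ (cylinderSigma Ω₀ (Δ : Set ι))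
  let g : (↥(Δ : Set ι) → Ω₀) → ℝ :=
    fun u => f (fun x => if hx : x ∈ (Δ : Set ι) then u ⟨x, hx⟩ else θ x)
  have hfg : f = g ∘ (fun ω (x : ↥(Δ : Set ι)) => ω (x : ι)) := by
    funext ω
    apply h
    intro x hx
    simp [hx]
  rw [hfg]
  have hg : Measurable g := by
    have : Finite (↥(Δ : Set ι) → Ω₀) := inferInstance
    exact measurable_of_finite g
  exact hg.comp (comap_measurable _)

theorem IsLocal.continuous [TopologicalSpace Ω₀] [DiscreteTopology Ω₀] [MeasurableSpace Ω₀]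
    {f : (ι → Ω₀) → ℝ} (hf : IsLocal f) : Continuous f := by
  obtain ⟨Δ, h⟩ := hf
  rw [continuous_iff_continuousAt]
  intro ω
  have : ∀ᶠ η in 𝓝 ω, ∀ x ∈ (Δ : Set ι), η x = ω x := by
    rw [Filter.eventually_all_finite Δ.finite_toSet]
    intro x _
    exact (continuous_apply x).continuousAt.eventually (isOpen_discrete {ω x} |>.mem_nhds rfl)
  refine ContinuousAt.congr (f := fun _ => f ω) continuousAt_const ?_
  filter_upwards [this] with η hη
  exact (eq_of_agree h hη).symm

theorem agree_nhds [TopologicalSpace Ω₀] [DiscreteTopology Ω₀] (S : Finset ι) (ω : ι → Ω₀) :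
    ∀ᶠ η in 𝓝 ω, ∀ x ∈ (S : Set ι), η x = ω x := by
  rw [Filter.eventually_all_finite S.finite_toSet]
  intro x _
  exact (continuous_apply x).continuousAt.eventually (isOpen_discrete {ω x} |>.mem_nhds rfl)

/-- The π-system of finitely based principal upper sets. -/
def upSys (ι Ω₀ : Type*) [LinearOrder Ω₀] [BoundedOrder Ω₀] : Set (Set (ι → Ω₀)) :=
  {s | ∃ a : ι → Ω₀, {x | a x ≠ ⊥}.Finite ∧ s = Set.Ici a}

theorem upSys_pi [LinearOrder Ω₀] [BoundedOrder Ω₀] : IsPiSystem (upSys ι Ω₀) := by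
  rintro _ ⟨a, ha, rfl⟩ _ ⟨b, hb, rfl⟩ -
  refine ⟨a ⊔ b, (ha.union hb).subset ?_, Set.Ici_inter_Ici⟩
  intro x hx
  by_contra hcon
  simp only [Set.mem_union, Set.mem_ofPred_eq, not_or, not_not] at hcon
  exact hx (by simp [hcon.1, hcon.2])

variable [Fintype Ω₀] [MeasurableSpace Ω₀] [DiscreteMeasurableSpace Ω₀]
    [LinearOrder Ω₀] [BoundedOrder Ω₀]

theorem upSys_agree {s : Set (ι → Ω₀)} (hs : s ∈ upSys ι Ω₀) : ∃ Δ : Finset ι,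
    ∀ σ τ : ι → Ω₀, (∀ x ∈ Δ, σ x = τ x) → (σ ∈ s ↔ τ ∈ s) := by
  obtain ⟨a, ha, rfl⟩ := hs
  have key : ∀ σ τ : ι → Ω₀, (∀ x ∈ ha.toFinset, σ x = τ x) → σ ∈ Set.Ici a → τ ∈ Set.Ici a := by
    intro σ τ h hσ x
    by_cases hx : a x = ⊥
    · simp [hx]
    · rw [← h x (by simpa using hx)]; exact hσ x
  exact ⟨ha.toFinset, fun σ τ h => ⟨key σ τ h, key τ σ fun x hx => (h x hx).symm⟩⟩

theorem isLocal_indicator {s : Set (ι → Ω₀)} {Δ : Finset ι}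
    (hs : ∀ σ τ : ι → Ω₀, (∀ x ∈ Δ, σ x = τ x) → (σ ∈ s ↔ τ ∈ s)) :
    IsLocal (s.indicator (1 : (ι → Ω₀) → ℝ)) := by
  apply isLocal_of_agree Δ
  intro σ τ h
  have := hs σ τ h
  by_cases hσ : σ ∈ s
  · simp [hσ, this.1 hσ]
  · simp [hσ, mt this.2 hσ]

theorem upSys_local {s : Set (ι → Ω₀)} (hs : s ∈ upSys ι Ω₀) :
    IsLocal (s.indicator (1 : (ι → Ω₀) → ℝ)) := by
  obtain ⟨Δ, h⟩ := upSys_agree hs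
  exact isLocal_indicator h

theorem mono_indicator {s : Set (ι → Ω₀)} (hs : IsUpperSet s) :
    Monotone (s.indicator (1 : (ι → Ω₀) → ℝ)) := by
  intro σ τ h
  by_cases hσ : σ ∈ s
  · simp [hσ, hs h hσ]
  · rw [Set.indicator_of_notMem hσ]
    exact Set.indicator_nonneg (by simp) _

theorem upSys_mono {s : Set (ι → Ω₀)} (hs : s ∈ upSys ι Ω₀) :
    Monotone (s.indicator (1 : (ι → Ω₀) → ℝ)) := by
  obtain ⟨a, -, rfl⟩ := hs
  exact mono_indicator (isUpperSet_Ici a)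

theorem measurableSet_of_local {s : Set (ι → Ω₀)}
    (hs : IsLocal (s.indicator (1 : (ι → Ω₀) → ℝ))) : MeasurableSet s := by
  have := hs.measurable (measurableSet_singleton (1 : ℝ))
  convert this
  ext σ
  by_cases h : σ ∈ s <;> simp [h]

theorem upSys_gen : (MeasurableSpace.pi : MeasurableSpace (ι → Ω₀)) =
    MeasurableSpace.generateFrom (upSys ι Ω₀) := by
  apply le_antisymm
  · apply iSup_le
    intro x
    rw [← measurable_iff_comap_le]
    have key : ∀ c : Ω₀, MeasurableSet[MeasurableSpace.generateFrom (upSys ι Ω₀)]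
        ((fun σ : ι → Ω₀ => σ x) ⁻¹' (Set.Ici c)) := by
      intro c
      apply MeasurableSpace.measurableSet_generateFrom
      refine ⟨Function.update ⊥ x c, (Set.finite_singleton x).subset ?_, ?_⟩
      · intro y hy
        by_contra hne
        exact hy (by simp [Function.update_of_ne hne])
      · ext σ
        simp only [Set.mem_preimage, Set.mem_Ici, Pi.le_def]
        constructor
        · intro h y
          by_cases hy : y = x
          · subst hy; simpa using h
          · simp [Function.update_of_ne hy]
        · intro h; simpa using h x
    apply @measurable_to_countable' _ _ _ _ (MeasurableSpace.generateFrom (upSys ι Ω₀))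
    intro c
    have : ((fun σ : ι → Ω₀ => σ x) ⁻¹' {c}) = ((fun σ : ι → Ω₀ => σ x) ⁻¹' (Set.Ici c)) \
        ⋃ c' ∈ Set.Ioi c, ((fun σ : ι → Ω₀ => σ x) ⁻¹' (Set.Ici c')) := by
      ext σ
      simp only [Set.mem_preimage, Set.mem_singleton_iff, Set.mem_sdiff, Set.mem_Ici, Set.mem_iUnion,
        Set.mem_Ioi, exists_prop, not_exists, not_and, not_le]
      constructor
      · rintro rfl; exact ⟨le_rfl, fun _ h => h⟩
      · rintro ⟨h1, h2⟩
        by_contra hne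
        exact lt_irrefl _ (h2 _ (lt_of_le_of_ne h1 (Ne.symm hne)))
    rw [this]
    apply MeasurableSet.diff (key c)
    exact MeasurableSet.biUnion (Set.to_countable _) (fun c' _ => key c')
  · apply MeasurableSpace.generateFrom_le
    intro s hs
    exact measurableSet_of_local (upSys_local hs)

theorem upSys_int {s : Set (ι → Ω₀)} (hs : s ∈ upSys ι Ω₀) (μ : Measure (ι → Ω₀)) :
    ∫ x, s.indicator (1 : (ι → Ω₀) → ℝ) x ∂μ = μ.real s :=
  integral_indicator_one (measurableSet_of_local (upSys_local hs))

theorem meas_ext {μ ν : Measure (ι → Ω₀)} [IsProbabilityMeasure μ] [IsProbabilityMeasure ν]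
    (h : ∀ s ∈ upSys ι Ω₀, ∫ x, s.indicator (1 : (ι → Ω₀) → ℝ) x ∂μ =
      ∫ x, s.indicator (1 : (ι → Ω₀) → ℝ) x ∂ν) : μ = ν := by
  refine ext_of_generate_finite (upSys ι Ω₀) upSys_gen upSys_pi ?_ (by simp)
  intro s hs
  have := h s hs
  rw [upSys_int hs, upSys_int hs] at this
  exact (measureReal_eq_measureReal_iff).1 this

section Top
variable [TopologicalSpace Ω₀] [DiscreteTopology Ω₀] [Countable ι]

theorem exists_ultra {α : Type*} (U : Ultrafilter α) (ν : α → Measure (ι → Ω₀))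
    (hν : ∀ i, IsProbabilityMeasure (ν i)) :
    ∃ μ : Measure (ι → Ω₀), IsProbabilityMeasure μ ∧ ∀ f : (ι → Ω₀) → ℝ, Continuous f →
      Tendsto (fun i => ∫ x, f x ∂(ν i)) U (𝓝 (∫ x, f x ∂μ)) := by
  let N : α → ProbabilityMeasure (ι → Ω₀) := fun i => ⟨ν i, hν i⟩
  obtain ⟨M, -, hM⟩ := isCompact_univ.ultrafilter_le_nhds (U.map N) (by simp)
  refine ⟨M, inferInstance, fun f hf => ?_⟩
  have hT : Tendsto N U (𝓝 M) := hM
  rw [ProbabilityMeasure.tendsto_iff_forall_integral_tendsto] at hT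
  exact hT (BoundedContinuousFunction.mkOfCompact ⟨f, hf⟩)

theorem tendsto_of_upSys {α : Type*} (l : Filter α) (ν : α → Measure (ι → Ω₀))
    (hν : ∀ i, IsProbabilityMeasure (ν i)) (μ : Measure (ι → Ω₀)) [IsProbabilityMeasure μ]
    (h : ∀ s ∈ upSys ι Ω₀, Tendsto (fun i => ∫ x, s.indicator (1 : (ι → Ω₀) → ℝ) x ∂(ν i)) l
      (𝓝 (∫ x, s.indicator (1 : (ι → Ω₀) → ℝ) x ∂μ)))
    (f : (ι → Ω₀) → ℝ) (hf : Continuous f) :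
    Tendsto (fun i => ∫ x, f x ∂(ν i)) l (𝓝 (∫ x, f x ∂μ)) := by
  rw [tendsto_iff_ultrafilter]
  intro U hU
  obtain ⟨μ', hμ', hT⟩ := exists_ultra U ν hν
  have : μ' = μ := meas_ext fun s hs =>
    tendsto_nhds_unique (hT _ (upSys_local hs).continuous) ((h s hs).mono_left hU)
  rw [← this]
  exact hT f hf

theorem exists_lim {α : Type*} (l : Filter α) [NeBot l] (ν : α → Measure (ι → Ω₀))
    (hν : ∀ i, IsProbabilityMeasure (ν i))
    (h : ∀ s ∈ upSys ι Ω₀, ∃ c, Tendsto (fun i => ∫ x, s.indicator (1 : (ι → Ω₀) → ℝ) x ∂(ν i)) l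
      (𝓝 c)) : ∃ μ : Measure (ι → Ω₀), IsProbabilityMeasure μ ∧ ∀ f : (ι → Ω₀) → ℝ, IsLocal f →
      Tendsto (fun i => ∫ x, f x ∂(ν i)) l (𝓝 (∫ x, f x ∂μ)) := by
  obtain ⟨μ, hμ, hT⟩ := exists_ultra (Ultrafilter.of l) ν hν
  refine ⟨μ, hμ, fun f hf => tendsto_of_upSys l ν hν μ ?_ f hf.continuous⟩
  intro s hs
  obtain ⟨c, hc⟩ := h s hs
  rw [tendsto_nhds_unique (hT _ (upSys_local hs).continuous) (hc.mono_left (Ultrafilter.of_le l))]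
  exact hc

end Top

section Domination
variable [TopologicalSpace Ω₀] [DiscreteTopology Ω₀] [Countable ι]

theorem integrable_mono {f : (ι → Ω₀) → ℝ} (hf : Measurable f) (hm : Monotone f)
    (μ : Measure (ι → Ω₀)) [IsProbabilityMeasure μ] : Integrable f μ := by
  refine Integrable.of_bound hf.aestronglyMeasurable (max |f ⊥| |f ⊤|)
    (Eventually.of_forall fun σ => ?_)
  exact abs_le_max_abs_abs (hm bot_le) (hm le_top)

theorem dom_set {μ ν : Measure (ι → Ω₀)} [IsProbabilityMeasure μ] [IsProbabilityMeasure ν]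
    (h : ∀ f : (ι → Ω₀) → ℝ, IsLocal f → Monotone f → ∫ x, f x ∂μ ≤ ∫ x, f x ∂ν)
    {A : Set (ι → Ω₀)} (hA : MeasurableSet A) (hup : IsUpperSet A) : μ A ≤ ν A := by
  refine le_of_forall_lt fun r hr => ?_
  obtain ⟨K, hKA, hK, hrK⟩ := hA.exists_lt_isCompact_of_ne_top (measure_ne_top μ A) hr
  let U : Finset ι → Set (ι → Ω₀) := fun S => {σ | ∃ κ ∈ K, ∀ x ∈ S, κ x ≤ σ x}
  have hUl : ∀ S, IsLocal ((U S).indicator (1 : (ι → Ω₀) → ℝ)) := by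
    intro S
    apply isLocal_indicator (Δ := S)
    intro σ τ hst
    constructor
    · rintro ⟨κ, hκ, hx⟩
      exact ⟨κ, hκ, fun x hxS => (hx x hxS).trans_eq (hst x hxS)⟩
    · rintro ⟨κ, hκ, hx⟩
      exact ⟨κ, hκ, fun x hxS => (hx x hxS).trans_eq (hst x hxS).symm⟩
  have hUup : ∀ S, IsUpperSet (U S) := by
    rintro S σ τ hst ⟨κ, hκ, hx⟩
    exact ⟨κ, hκ, fun x hxS => (hx x hxS).trans (hst x)⟩
  have hUm : ∀ S, MeasurableSet (U S) := fun S => measurableSet_of_local (hUl S)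
  have hle : ∀ S, μ K ≤ ν (U S) := by
    intro S
    have h1 : μ K ≤ μ (U S) := measure_mono fun κ hκ => ⟨κ, hκ, fun _ _ => le_rfl⟩
    refine h1.trans ?_
    have := h _ (hUl S) (mono_indicator (hUup S))
    rw [integral_indicator_one (hUm S), integral_indicator_one (hUm S)] at this
    exact (ENNReal.toReal_le_toReal (measure_ne_top _ _) (measure_ne_top _ _)).1 this
  have hanti : Antitone U := by
    rintro S T hST σ ⟨κ, hκ, hx⟩
    exact ⟨κ, hκ, fun x hxS => hx x (hST hxS)⟩
  have hlim := tendsto_measure_iInter_atTop (μ := ν) (fun S => (hUm S).nullMeasurableSet) hanti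
    ⟨∅, measure_ne_top _ _⟩
  have hK2 : μ K ≤ ν (⋂ S, U S) := ge_of_tendsto' hlim hle
  have hsub : (⋂ S, U S) ⊆ A := by
    intro σ hσ
    rw [Set.mem_iInter] at hσ
    let t : Finset ι → Set (ι → Ω₀) := fun S => K ∩ {κ | ∀ x ∈ S, κ x ≤ σ x}
    have hcl : ∀ S : Finset ι, IsClosed {κ : ι → Ω₀ | ∀ x ∈ S, κ x ≤ σ x} := by
      intro S
      have : {κ : ι → Ω₀ | ∀ x ∈ S, κ x ≤ σ x} = ⋂ x ∈ S, (fun κ : ι → Ω₀ => κ x) ⁻¹' (Set.Iic (σ x)) := by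
        ext κ; simp
      rw [this]
      exact isClosed_biInter fun x _ => (isClosed_discrete _).preimage (continuous_apply x)
    obtain ⟨κ, hκ⟩ := IsCompact.nonempty_iInter_of_directed_nonempty_isCompact_isClosed t
      (by
        intro S T
        exact ⟨S ∪ T, fun κ hκ => ⟨hκ.1, fun x hx => hκ.2 x (Finset.mem_union_left _ hx)⟩,
          fun κ hκ => ⟨hκ.1, fun x hx => hκ.2 x (Finset.mem_union_right _ hx)⟩⟩)
      (by
        intro S
        obtain ⟨κ, hκ, hx⟩ := hσ S
        exact ⟨κ, hκ, hx⟩)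
      (fun S => hK.inter_right (hcl S)) (fun S => hK.isClosed.inter (hcl S))
    rw [Set.mem_iInter] at hκ
    refine hup ?_ (hKA (hκ ∅).1)
    intro x
    exact (hκ {x}).2 x (Finset.mem_singleton_self x)
  exact hrK.trans_le (hK2.trans (measure_mono hsub))

theorem dom_int {μ ν : Measure (ι → Ω₀)} [IsProbabilityMeasure μ] [IsProbabilityMeasure ν]
    (h : ∀ f : (ι → Ω₀) → ℝ, IsLocal f → Monotone f → ∫ x, f x ∂μ ≤ ∫ x, f x ∂ν)
    {f : (ι → Ω₀) → ℝ} (hf : Measurable f) (hm : Monotone f) : ∫ x, f x ∂μ ≤ ∫ x, f x ∂ν := by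
  have hg0 : ∀ σ, 0 ≤ f σ - f ⊥ := fun σ => sub_nonneg.2 (hm bot_le)
  have hgm : Measurable (fun σ => f σ - f ⊥) := hf.sub_const _
  have key : ∫ x, (f x - f ⊥) ∂μ ≤ ∫ x, (f x - f ⊥) ∂ν := by
    have hi : Integrable (fun σ => f σ - f ⊥) ν := (integrable_mono hf hm ν).sub (integrable_const _)
    rw [integral_eq_lintegral_of_nonneg_ae (Eventually.of_forall hg0) hgm.aestronglyMeasurable,
      integral_eq_lintegral_of_nonneg_ae (Eventually.of_forall hg0) hgm.aestronglyMeasurable]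
    apply ENNReal.toReal_mono hi.lintegral_lt_top.ne
    rw [lintegral_eq_lintegral_meas_lt μ (Eventually.of_forall hg0) hgm.aemeasurable,
      lintegral_eq_lintegral_meas_lt ν (Eventually.of_forall hg0) hgm.aemeasurable]
    apply lintegral_mono
    intro t
    apply dom_set h (measurableSet_lt measurable_const hgm)
    intro σ τ hst hσ
    exact lt_of_lt_of_le hσ (sub_le_sub_right (hm hst) _)
  rw [integral_sub (integrable_mono hf hm μ) (integrable_const _),
    integral_sub (integrable_mono hf hm ν) (integrable_const _)] at key
  simpa using key

end Domination

section Splice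

theorem splice_anti {S T : Set ι} (h : S ⊆ T) (ω : ι → Ω₀) :
    splice T ω (fun _ => ⊤) ≤ splice S ω (fun _ => ⊤) := by
  intro x
  simp only [splice]
  by_cases hS : x ∈ S
  · simp [hS, h hS]
  · simp [hS]

theorem splice_mono (S : Set ι) {ω ω' θ : ι → Ω₀} (h : ω ≤ ω') :
    splice S ω θ ≤ splice S ω' θ := by
  intro x
  simp only [splice]
  by_cases hS : x ∈ S
  · simpa [hS] using h x
  · simp [hS]

theorem le_splice (S : Set ι) (ω : ι → Ω₀) : ω ≤ splice S ω (fun _ => ⊤) := by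
  intro x
  simp only [splice]
  by_cases hS : x ∈ S <;> simp [hS]

theorem splice_splice {S T : Set ι} (h : S ⊆ T) (ω θ : ι → Ω₀) :
    splice T (splice S ω θ) θ = splice S ω θ := by
  funext x
  simp only [splice]
  by_cases hS : x ∈ S
  · simp [hS, h hS]
  · simp [hS]

theorem splice_congr {S : Set ι} {ω η : ι → Ω₀} (h : ∀ x ∈ S, η x = ω x) (θ : ι → Ω₀) :
    splice S η θ = splice S ω θ := by
  funext x
  simp only [splice]
  by_cases hS : x ∈ S
  · simp [hS, h x hS]
  · simp [hS]

theorem measurable_splice (S Δ : Set ι) (θ : ι → Ω₀) :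
    @Measurable _ _ (cylinderSigma Ω₀ Δ) (cylinderSigma Ω₀ Δ) (fun ω => splice S ω θ) := by
  unfold cylinderSigma
  rw [measurable_comap_iff]
  let _ : MeasurableSpace (ι → Ω₀) :=
    MeasurableSpace.comap (fun ω (x : Δ) => ω (x : ι)) MeasurableSpace.pi
  refine measurable_pi_iff.2 fun x => ?_
  by_cases hS : (x : ι) ∈ S
  · have : (fun ω : ι → Ω₀ => ((fun ω (x : Δ) => ω (x : ι)) ∘ fun ω => splice S ω θ) ω x)
        = (fun u : Δ → Ω₀ => u x) ∘ (fun ω (x : Δ) => ω (x : ι)) := by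
      funext ω; simp [splice, hS]
    rw [this]
    exact (measurable_pi_apply x).comp (comap_measurable _)
  · have : (fun ω : ι → Ω₀ => ((fun ω (x : Δ) => ω (x : ι)) ∘ fun ω => splice S ω θ) ω x)
        = fun _ => θ x := by
      funext ω; simp [splice, hS]
    rw [this]
    exact measurable_const

end Splice

section Spec
variable [Countable ι]

theorem spec_measurable (γ : Specification ι Ω₀) (Λ : Finset ι) : Measurable (γ.k Λ) :=
  Measure.measurable_of_measurable_coe _ fun A hA =>
    (γ.meas Λ A hA).mono (cylinderSigma_le _) le_rfl

theorem bind_real {μ : Measure (ι → Ω₀)} {k : (ι → Ω₀) → Measure (ι → Ω₀)} (hk : Measurable k)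
    (hp : ∀ ω, IsProbabilityMeasure (k ω)) {s : Set (ι → Ω₀)} (hs : MeasurableSet s) :
    (μ.bind k).real s = ∫ σ, (k σ).real s ∂μ := by
  unfold Measure.real
  rw [Measure.bind_apply hs hk.aemeasurable, integral_toReal]
  · exact (Measure.measurable_coe hs).comp hk |>.aemeasurable
  · exact Eventually.of_forall fun σ => measure_lt_top _ _

theorem spec_real_measurable (γ : Specification ι Ω₀) (Λ : Finset ι) {s : Set (ι → Ω₀)}
    (hs : MeasurableSet s) :
    Measurable[cylinderSigma Ω₀ ((Λ : Set ι))ᶜ] (fun ω => (γ.k Λ ω).real s) :=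
  ENNReal.measurable_toReal.comp (γ.meas Λ s hs)

theorem spec_ae_eq (γ : Specification ι Ω₀) (Λ : Finset ι) (ω : ι → Ω₀) :
    ∀ᵐ σ ∂(γ.k Λ ω), ∀ x ∉ Λ, σ x = ω x := by
  have := γ.isProb Λ ω
  rw [ae_all_iff]
  intro x
  by_cases hx : x ∈ Λ
  · simp [hx]
  have hB : MeasurableSet[cylinderSigma Ω₀ ((Λ : Set ι))ᶜ] {σ : ι → Ω₀ | σ x = ω x} := by
    refine ⟨{u | u ⟨x, by simpa using hx⟩ = ω x}, ?_, rfl⟩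
    have hmp : Measurable (fun u : ↥((Λ : Set ι)ᶜ) → Ω₀ => u ⟨x, by simpa using hx⟩) :=
      measurable_pi_apply _
    exact hmp (measurableSet_singleton (ω x))
  have h1 := γ.proper Λ _ hB ω
  have h2 : (γ.k Λ ω) {σ : ι → Ω₀ | σ x = ω x} = 1 := by simpa using h1
  have h3 := (prob_compl_eq_zero_iff (cylinderSigma_le _ _ hB)).2 h2
  filter_upwards [compl_mem_ae_iff.2 h3] with σ hσ _
  simpa using hσ

variable [TopologicalSpace Ω₀] [DiscreteTopology Ω₀]

theorem exists_plus (γ : Specification ι Ω₀) (hmono : MonoPreserving γ) :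
    ∃ γp : Specification ι Ω₀, IsDirLimitSpec γ γp (fun _ => (⊤ : Ω₀)) := by
  have hanti : ∀ Λ (f : (ι → Ω₀) → ℝ), Measurable f → Monotone f → ∀ ω,
      Antitone (fun S : Finset ι => specInt γ Λ f (splice (S : Set ι) ω (fun _ => ⊤))) :=
    fun Λ f hf hm ω S T hST => hmono Λ f hf hm (splice_anti (by exact_mod_cast hST) ω)
  have hex : ∀ Λ ω, ∃ μ : Measure (ι → Ω₀), IsProbabilityMeasure μ ∧ ∀ f : (ι → Ω₀) → ℝ,
      IsLocal f → Tendsto (fun S : Finset ι => ∫ x, f x ∂(γ.k Λ (splice (S : Set ι) ω (fun _ => ⊤))))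
        atTop (𝓝 (∫ x, f x ∂μ)) := by
    intro Λ ω
    apply exists_lim
    · intro S; exact γ.isProb _ _
    · intro s hs
      refine ⟨_, tendsto_atTop_ciInf (hanti Λ _ (upSys_local hs).measurable (upSys_mono hs) ω) ?_⟩
      refine ⟨0, ?_⟩
      rintro _ ⟨S, rfl⟩
      exact integral_nonneg fun σ => Set.indicator_nonneg (by simp) _
  choose k hprob hlim using hex
  have hlim' : ∀ Λ ω, ∀ s ∈ upSys ι Ω₀, Tendsto
      (fun S : Finset ι => (γ.k Λ (splice (S : Set ι) ω (fun _ => ⊤))).real s) atTop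
      (𝓝 ((k Λ ω).real s)) := by
    intro Λ ω s hs
    simpa only [upSys_int hs] using hlim Λ ω _ (upSys_local hs)
  have hms : ∀ s ∈ upSys ι Ω₀, MeasurableSet s := fun s hs => measurableSet_of_local (upSys_local hs)
  have hreal : ∀ Λ : Finset ι, ∀ s ∈ upSys ι Ω₀,
      Measurable[cylinderSigma Ω₀ ((Λ : Set ι))ᶜ] (fun ω => (k Λ ω).real s) := by
    intro Λ s hs
    refine @measurable_of_tendsto_metrizable' _ _ (cylinderSigma Ω₀ ((Λ : Set ι))ᶜ) _ _ _ _ _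
      (fun (S : Finset ι) ω => (γ.k Λ (splice (S : Set ι) ω (fun _ => ⊤))).real s) _ atTop _ _ ?_ ?_
    · intro S
      exact @Measurable.comp _ _ _ (cylinderSigma Ω₀ ((Λ : Set ι))ᶜ)
        (cylinderSigma Ω₀ ((Λ : Set ι))ᶜ) _ _ _ (spec_real_measurable γ Λ (hms s hs))
        (measurable_splice _ _ _)
    · rw [tendsto_pi_nhds]
      intro ω
      exact hlim' Λ ω s hs
  have hkm : ∀ Λ : Finset ι, @Measurable _ _ (cylinderSigma Ω₀ ((Λ : Set ι))ᶜ) _ (k Λ) := by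
    intro Λ
    refine @Measurable.measure_of_isPiSystem_of_isProbabilityMeasure _ _
      (cylinderSigma Ω₀ ((Λ : Set ι))ᶜ) _ (k Λ) (hprob Λ) (upSys ι Ω₀) upSys_gen upSys_pi ?_
    intro s hs
    have : (fun ω => k Λ ω s) = fun ω => ENNReal.ofReal ((k Λ ω).real s) := by
      funext ω
      have := hprob Λ ω
      rw [ofReal_measureReal]
    rw [this]
    exact ENNReal.measurable_ofReal.comp (hreal Λ s hs)
  have hkm' : ∀ Λ : Finset ι, Measurable (k Λ) := fun Λ => (hkm Λ).mono (cylinderSigma_le _) le_rfl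
  refine ⟨{ k := k, isProb := hprob, meas := ?_, proper := ?_, consistent := ?_ }, ?_⟩
  · intro Λ A hA
    exact (Measure.measurable_coe hA).comp (hkm Λ)
  · intro Λ B hB ω
    have := hprob Λ ω
    have hae : ∀ᵐ σ ∂(k Λ ω), ∀ x ∈ ((Λ : Set ι))ᶜ, σ x = ω x := by
      rw [ae_all_iff]
      intro x
      by_cases hx : x ∈ Λ
      · simp [hx]
      let s : Set (ι → Ω₀) := {σ | σ x = ω x}
      have hl : IsLocal (s.indicator (1 : (ι → Ω₀) → ℝ)) := by
        apply isLocal_indicator (Δ := {x})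
        intro σ τ h
        simp only [s, Set.mem_ofPred_eq]
        rw [h x (by simp)]
      have hs := measurableSet_of_local hl
      have h1 := hlim Λ ω _ hl
      simp only [integral_indicator_one hs] at h1
      have h2 : ∀ᶠ S : Finset ι in atTop,
          (γ.k Λ (splice (S : Set ι) ω (fun _ => ⊤))).real s = 1 := by
        filter_upwards [eventually_ge_atTop {x}] with S hS
        have := γ.isProb Λ (splice (S : Set ι) ω (fun _ => ⊤))
        have h3 := spec_ae_eq γ Λ (splice (S : Set ι) ω (fun _ => ⊤))
        have h4 : ∀ᵐ σ ∂(γ.k Λ (splice (S : Set ι) ω (fun _ => ⊤))), σ ∈ s := by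
          filter_upwards [h3] with σ hσ
          have h5 := hσ x hx
          have hxS : x ∈ S := hS (by simp)
          simpa [splice, hxS, s] using h5
        have h6 := (mem_ae_iff_prob_eq_one hs).1 h4
        simp [Measure.real, h6]
      have h3 : (k Λ ω).real s = 1 :=
        tendsto_nhds_unique h1 ((tendsto_congr' h2).2 tendsto_const_nhds)
      have h4 : (k Λ ω) s = 1 := by
        rw [← ofReal_measureReal (μ := k Λ ω) (s := s), h3]; simp
      filter_upwards [(mem_ae_iff_prob_eq_one hs).2 h4] with σ hσ _
      exact hσ
    have hBm := cylinderSigma_le _ _ hB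
    by_cases hω : ω ∈ B
    · have : ∀ᵐ σ ∂(k Λ ω), σ ∈ B := by
        filter_upwards [hae] with σ hσ
        exact (mem_of_agree hB hσ).2 hω
      rw [(mem_ae_iff_prob_eq_one hBm).1 this]
      simp [hω]
    · have : ∀ᵐ σ ∂(k Λ ω), σ ∉ B := by
        filter_upwards [hae] with σ hσ
        exact fun h => hω ((mem_of_agree hB hσ).1 h)
      rw [measure_eq_zero_iff_ae_notMem.2 this]
      simp [hω]
  · intro Λ Λ' hΛ ω
    have i1 := hprob Λ' ω
    have i2 : IsProbabilityMeasure ((k Λ' ω).bind (k Λ)) :=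
      isProbabilityMeasure_bind (hkm' Λ).aemeasurable (Eventually.of_forall (hprob Λ))
    refine meas_ext fun s hs => ?_
    rw [upSys_int hs, upSys_int hs, bind_real (hkm' Λ) (hprob Λ) (hms s hs)]
    have hanti' : ∀ Λ ω, Antitone
        (fun S : Finset ι => (γ.k Λ (splice (S : Set ι) ω (fun _ => ⊤))).real s) := by
      intro Λ ω
      have := hanti Λ _ (upSys_local hs).measurable (upSys_mono hs) ω
      simpa only [specInt, upSys_int hs] using this
    have hmono' : ∀ Λ, Monotone (fun ω => (γ.k Λ ω).real s) := by
      intro Λ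
      intro a b hab
      have := hmono Λ _ (upSys_local hs).measurable (upSys_mono hs) hab
      simpa only [specInt, upSys_int hs] using this
    let g : Finset ι → (ι → Ω₀) → ℝ :=
      fun S σ => (γ.k Λ (splice (S : Set ι) σ (fun _ => ⊤))).real s
    have hgl : ∀ S, IsLocal (g S) := by
      intro S
      apply isLocal_of_agree S
      intro σ τ h
      simp only [g]
      rw [splice_congr (S := (S : Set ι)) (fun x hx => h x hx)]
    have hgm : ∀ S, Monotone (g S) := fun S σ τ h => hmono' Λ (splice_mono _ h)
    have hle1 : ∀ S σ, g S σ ≤ 1 := by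
      intro S σ
      have := γ.isProb Λ (splice (S : Set ι) σ (fun _ => ⊤))
      exact measureReal_le_one
    -- a_S → target
    have hA : Tendsto (fun S => ∫ σ, g S σ ∂(k Λ' ω)) atTop (𝓝 (∫ σ, (k Λ σ).real s ∂(k Λ' ω))) := by
      refine tendsto_integral_filter_of_dominated_convergence (fun _ => 1)
        (Eventually.of_forall fun S => (hgl S).measurable.aestronglyMeasurable)
        (Eventually.of_forall fun S => Eventually.of_forall fun σ => ?_) (integrable_const _)
        (Eventually.of_forall fun σ => hlim' Λ σ s hs)
      rw [Real.norm_of_nonneg measureReal_nonneg]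
      exact hle1 S σ
    have hb := hlim' Λ' ω s hs
    have hcons : ∀ η, (γ.k Λ' η).real s = ∫ σ, (γ.k Λ σ).real s ∂(γ.k Λ' η) := by
      intro η
      rw [← bind_real (spec_measurable γ Λ) (γ.isProb Λ) (hms s hs), γ.consistent hΛ]
    have hint : ∀ η, Integrable (fun σ => (γ.k Λ σ).real s) (γ.k Λ' η) := by
      intro η
      have := γ.isProb Λ' η
      exact integrable_mono ((spec_real_measurable γ Λ (hms s hs)).mono (cylinderSigma_le _) le_rfl)
        (hmono' Λ) _
    apply le_antisymm
    · refine ge_of_tendsto' hb fun T => ?_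
      let S := Λ' ∪ T
      have h1 : (∫ σ, (k Λ σ).real s ∂(k Λ' ω)) ≤ ∫ σ, g S σ ∂(k Λ' ω) := by
        refine Antitone.le_of_tendsto ?_ hA S
        intro S1 S2 h12
        exact integral_mono (integrable_mono (hgl _).measurable (hgm _) _)
          (integrable_mono (hgl _).measurable (hgm _) _) fun σ => hanti' Λ σ h12
      have h2 : ∫ σ, g S σ ∂(k Λ' ω) ≤
          ∫ σ, g S σ ∂(γ.k Λ' (splice (T : Set ι) ω (fun _ => ⊤))) :=
        Antitone.le_of_tendsto (hanti Λ' _ (hgl S).measurable (hgm S) ω) (hlim Λ' ω _ (hgl S)) T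
      refine h1.trans (h2.trans_eq ?_)
      rw [hcons]
      apply integral_congr_ae
      filter_upwards [spec_ae_eq γ Λ' (splice (T : Set ι) ω (fun _ => ⊤))] with σ hσ
      have : splice (S : Set ι) σ (fun _ => (⊤ : Ω₀)) = σ := by
        funext x
        by_cases hx : x ∈ S
        · simp [splice, hx]
        · have hx1 : x ∉ Λ' := fun h => hx (Finset.mem_union_left _ h)
          have hx2 : x ∉ T := fun h => hx (Finset.mem_union_right _ h)
          rw [hσ x hx1]
          simp [splice, hx, hx2]
      simp only [g, this]
    · refine ge_of_tendsto' hA fun S => ?_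
      refine le_of_tendsto_of_tendsto' hb (hlim Λ' ω _ (hgl S)) fun T => ?_
      rw [hcons]
      have := γ.isProb Λ' (splice (T : Set ι) ω (fun _ => ⊤))
      exact integral_mono (hint _) (integrable_mono (hgl _).measurable (hgm _) _)
        fun σ => hmono' Λ (le_splice _ σ)
  · intro Λ f hf ω
    exact hlim Λ ω f hf

theorem plus_le {γ γp : Specification ι Ω₀} (hmono : MonoPreserving γ)
    (hl : IsDirLimitSpec γ γp (fun _ => (⊤ : Ω₀))) {Λ : Finset ι} {f : (ι → Ω₀) → ℝ}
    (hf : IsLocal f) (hm : Monotone f) (ω : ι → Ω₀) : specInt γ Λ f ω ≤ specInt γp Λ f ω :=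
  ge_of_tendsto' (hl Λ f hf ω) fun _ => hmono Λ f hf.measurable hm (le_splice _ ω)

theorem plus_mono {γ γp : Specification ι Ω₀} (hmono : MonoPreserving γ)
    (hl : IsDirLimitSpec γ γp (fun _ => (⊤ : Ω₀))) : MonoPreserving γp := by
  intro Λ f hf hm ω ω' h
  have := γp.isProb Λ ω
  have := γp.isProb Λ ω'
  refine dom_int ?_ hf hm
  intro g hg hgm
  exact le_of_tendsto_of_tendsto' (hl Λ g hg ω) (hl Λ g hg ω') fun S =>
    hmono Λ g hg.measurable hgm (splice_mono _ h)

theorem plus_usc {γ γp : Specification ι Ω₀} (hmono : MonoPreserving γ)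
    (hl : IsDirLimitSpec γ γp (fun _ => (⊤ : Ω₀))) {Λ : Finset ι} {f : (ι → Ω₀) → ℝ}
    (hf : IsLocal f) (hm : Monotone f) (ω : ι → Ω₀) {c : ℝ} (hc : specInt γp Λ f ω < c) :
    ∀ᶠ η in 𝓝 ω, specInt γp Λ f η < c := by
  obtain ⟨S, hS⟩ := ((hl Λ f hf ω).eventually_lt_const hc).exists
  filter_upwards [agree_nhds S ω] with η hη
  have hanti : Antitone (fun S : Finset ι => specInt γ Λ f (splice (S : Set ι) η (fun _ => ⊤))) :=
    fun S T hST => hmono Λ f hf.measurable hm (splice_anti (by exact_mod_cast hST) η)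
  have := hanti.le_of_tendsto (hl Λ f hf η) S
  rw [splice_congr hη] at this
  exact this.trans_lt hS

theorem dir_quasilocal {γ γp : Specification ι Ω₀} {θ : ι → Ω₀}
    (hl : IsDirLimitSpec γ γp θ) : SpecQuasilocalInDir γp θ := by
  intro Λ f hf ω
  refine (hl Λ f hf ω).congr fun S => ?_
  refine tendsto_nhds_unique (tendsto_const_nhds.congr' ?_)
    (hl Λ f hf (splice (S : Set ι) ω θ))
  filter_upwards [eventually_ge_atTop S] with T hT
  rw [splice_splice (by exact_mod_cast hT)]

/-- The dual linear order on the same type. -/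
@[reducible] def dualLO (Ω₀ : Type*) [LinearOrder Ω₀] : LinearOrder Ω₀ :=
  OrderDual.instLinearOrder Ω₀

/-- The dual bounded order on the same type. -/
@[reducible] def dualBO (Ω₀ : Type*) [LinearOrder Ω₀] [BoundedOrder Ω₀] :
    @BoundedOrder Ω₀ (dualLO Ω₀).toLE :=
  OrderDual.instBoundedOrder Ω₀

theorem minus_pack (γ : Specification ι Ω₀) (hmono : MonoPreserving γ) :
    ∃ γm : Specification ι Ω₀, IsDirLimitSpec γ γm (fun _ => (⊥ : Ω₀)) ∧ MonoPreserving γm ∧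
      (∀ Λ (f : (ι → Ω₀) → ℝ), IsLocal f → Monotone f → ∀ ω,
        specInt γm Λ f ω ≤ specInt γ Λ f ω) ∧
      (∀ Λ (f : (ι → Ω₀) → ℝ), IsLocal f → Monotone f → ∀ ω c, c < specInt γm Λ f ω →
        ∀ᶠ η in 𝓝 ω, c < specInt γm Λ f η) := by
  have hneg : ∀ (γ : Specification ι Ω₀) Λ (f : (ι → Ω₀) → ℝ) ω,
      specInt γ Λ (fun x => - f x) ω = - specInt γ Λ f ω := by
    intro γ Λ f ω; exact integral_neg _
  have hnl : ∀ f : (ι → Ω₀) → ℝ, IsLocal f → IsLocal (fun x => - f x) := by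
    rintro f ⟨Δ, h⟩
    exact ⟨Δ, measurable_neg.comp h⟩
  have hmono' : @MonoPreserving ι Ω₀ _ (dualLO Ω₀).toPreorder γ := by
    intro Λ f hf hm ω ω' h
    have h1 := hmono Λ (fun x => - f x) hf.neg (fun a b hab => neg_le_neg (hm hab)) (a := ω') (b := ω) h
    rw [hneg, hneg] at h1
    exact neg_le_neg_iff.1 h1
  obtain ⟨γm, hl⟩ := @exists_plus ι Ω₀ _ _ _ (dualLO Ω₀) (dualBO Ω₀) _ _ _ γ hmono'
  refine ⟨γm, hl, ?_, ?_, ?_⟩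
  · have hp := @plus_mono ι Ω₀ _ _ _ (dualLO Ω₀) (dualBO Ω₀) _ _ _ γ γm hmono' hl
    intro Λ f hf hm ω ω' h
    have h1 := hp Λ (fun x => - f x) hf.neg (fun a b hab => neg_le_neg (hm hab)) (a := ω') (b := ω) h
    rw [hneg, hneg] at h1
    exact neg_le_neg_iff.1 h1
  · intro Λ f hf hm ω
    have h1 := @plus_le ι Ω₀ _ _ _ (dualLO Ω₀) (dualBO Ω₀) _ _ _ γ γm hmono' hl Λ (fun x => - f x) (hnl f hf)
      (fun a b hab => neg_le_neg (hm hab)) ω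
    rw [hneg, hneg] at h1
    exact neg_le_neg_iff.1 h1
  · intro Λ f hf hm ω c hc
    have h1 := @plus_usc ι Ω₀ _ _ _ (dualLO Ω₀) (dualBO Ω₀) _ _ _ γ γm hmono' hl Λ (fun x => - f x) (hnl f hf)
      (fun a b hab => neg_le_neg (hm hab)) ω (-c) (by rw [hneg]; exact neg_lt_neg hc)
    filter_upwards [h1] with η hη
    rw [hneg] at hη
    exact neg_lt_neg_iff.1 hη

theorem sandwich {X : Type*} [TopologicalSpace X] {m h p : X → ℝ} {ω : X}
    (h1 : ∀ η, m η ≤ h η) (h2 : ∀ η, h η ≤ p η) (he : p ω = m ω)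
    (hp : ∀ c, p ω < c → ∀ᶠ η in 𝓝 ω, p η < c) (hm : ∀ c, c < m ω → ∀ᶠ η in 𝓝 ω, c < m η) :
    ContinuousAt h ω := by
  have e : h ω = p ω := le_antisymm (h2 ω) (he ▸ h1 ω)
  unfold ContinuousAt
  rw [tendsto_order]
  constructor
  · intro c hc
    rw [e, he] at hc
    exact (hm c hc).mono fun η hη => hη.trans_le (h1 η)
  · intro c hc
    rw [e] at hc
    exact (hp c hc).mono fun η hη => (h2 η).trans_lt hη

theorem cont_of_upSys {γ : Specification ι Ω₀} {Λ : Finset ι} {ω : ι → Ω₀}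
    (h : ∀ s ∈ upSys ι Ω₀, ContinuousAt (specInt γ Λ (s.indicator (1 : (ι → Ω₀) → ℝ))) ω)
    {f : (ι → Ω₀) → ℝ} (hf : IsLocal f) : ContinuousAt (specInt γ Λ f) ω := by
  have := γ.isProb Λ ω
  exact tendsto_of_upSys (𝓝 ω) (γ.k Λ) (γ.isProb Λ) (γ.k Λ ω) h f hf.continuous

end Spec

theorem dir_transInv {d : ℕ} [TopologicalSpace Ω₀] [DiscreteTopology Ω₀]
    {γ γ' : Specification (Site d) Ω₀} {c : Ω₀}
    (hl : IsDirLimitSpec γ γ' (fun _ => c)) (ht : TransInvSpec γ) : TransInvSpec γ' := by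
  intro i Λ ω
  have i1 := γ'.isProb (Λ.image (· + i)) (shift i ω)
  have i2 := γ'.isProb Λ ω
  have hsm : Measurable (shift i : (Site d → Ω₀) → (Site d → Ω₀)) := by
    refine measurable_pi_iff.2 fun x => ?_
    exact measurable_pi_apply (x - i)
  have i3 : IsProbabilityMeasure ((γ'.k Λ ω).map (shift i)) :=
    Measure.isProbabilityMeasure_map hsm.aemeasurable
  refine meas_ext fun s hs => ?_
  have hloc := upSys_local hs
  rw [integral_map hsm.aemeasurable hloc.measurable.aestronglyMeasurable]
  have hloc2 : IsLocal (fun σ : Site d → Ω₀ => s.indicator (1 : (Site d → Ω₀) → ℝ) (shift i σ)) := by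
    obtain ⟨Δ, h⟩ := upSys_agree hs
    apply isLocal_of_agree (Δ.image (· - i))
    intro σ τ hst
    have := h (shift i σ) (shift i τ) fun x hx => hst _ (Finset.mem_image_of_mem _ hx)
    by_cases hσ : shift i σ ∈ s
    · rw [Set.indicator_of_mem hσ, Set.indicator_of_mem (this.1 hσ)]; rfl
    · rw [Set.indicator_of_notMem hσ, Set.indicator_of_notMem (mt this.2 hσ)]
  have h1 := hl (Λ.image (· + i)) _ hloc (shift i ω)
  have h2 := hl Λ _ hloc2 ω
  have htend : Tendsto (fun S : Finset (Site d) => S.image (· - i)) atTop atTop := by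
    refine tendsto_atTop.2 fun T => ?_
    filter_upwards [eventually_ge_atTop (T.image (· + i))] with S hS
    intro x hx
    exact Finset.mem_image.2 ⟨x + i, hS (Finset.mem_image_of_mem _ hx), by simp⟩
  refine tendsto_nhds_unique h1 ((h2.comp htend).congr fun S => ?_)
  have hsp : splice (S : Set (Site d)) (shift i ω) (fun _ => c) =
      shift i (splice ((S.image (· - i) : Finset (Site d)) : Set (Site d)) ω (fun _ => c)) := by
    funext x
    have hiff : x - i ∈ S.image (· - i) ↔ x ∈ S := by
      simp
    simp only [splice, shift, Finset.mem_coe, hiff]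
  simp only [Function.comp, specInt]
  rw [hsp, ht, integral_map hsm.aemeasurable hloc.measurable.aestronglyMeasurable]

end Helpers

/-- For a monotonicity-preserving specification `γ`, the limits with "+" and "−"
boundary conditions exist and define monotonicity-preserving specifications `γ⁺`
(right continuous) and `γ⁻` (left continuous); they are translation invariant if `γ`
is; `γ⁻_Λ f ≤ γ_Λ f ≤ γ⁺_Λ f` for increasing local `f`; and all three specifications
are continuous at every configuration of the set `Ω_±` where `γ⁺` and `γ⁻` agree. -/
theorem mono_spec_plus_minus_limits
    {Ω₀ : Type*} [Fintype Ω₀] [MeasurableSpace Ω₀] [DiscreteMeasurableSpace Ω₀]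
    [LinearOrder Ω₀] [BoundedOrder Ω₀] [TopologicalSpace Ω₀] [DiscreteTopology Ω₀] {d : ℕ}
    (γ : Specification (Site d) Ω₀) (hmono : MonoPreserving γ) :
    ∃ γp γm : Specification (Site d) Ω₀,
      IsDirLimitSpec γ γp (fun _ => (⊤ : Ω₀)) ∧
      IsDirLimitSpec γ γm (fun _ => (⊥ : Ω₀)) ∧
      MonoPreserving γp ∧ MonoPreserving γm ∧
      SpecQuasilocalInDir γp (fun _ => (⊤ : Ω₀)) ∧
      SpecQuasilocalInDir γm (fun _ => (⊥ : Ω₀)) ∧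
      (TransInvSpec γ → TransInvSpec γp ∧ TransInvSpec γm) ∧
      (∀ Λ f, IsLocal f → Monotone f → ∀ ω,
        specInt γm Λ f ω ≤ specInt γ Λ f ω ∧ specInt γ Λ f ω ≤ specInt γp Λ f ω) ∧
      (∀ ω ∈ agreeSet γp γm, ∀ Λ f, IsLocal f →
        ContinuousAt (specInt γp Λ f) ω ∧ ContinuousAt (specInt γm Λ f) ω ∧
        ContinuousAt (specInt γ Λ f) ω) := by
  obtain ⟨γp, hp⟩ := exists_plus γ hmono
  obtain ⟨γm, hm, hmm, hmle, hmlsc⟩ := minus_pack γ hmono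
  refine ⟨γp, γm, hp, hm, plus_mono hmono hp, hmm, dir_quasilocal hp, dir_quasilocal hm,
    fun ht => ⟨dir_transInv hp ht, dir_transInv hm ht⟩,
    fun Λ f hf hfm ω => ⟨hmle Λ f hf hfm ω, plus_le hmono hp hf hfm ω⟩, ?_⟩
  intro ω hω Λ f hf
  have key : ∀ h : (Site d → Ω₀) → ℝ, ∀ s ∈ upSys (Site d) Ω₀,
      (∀ η, specInt γm Λ (s.indicator 1) η ≤ h η) →
      (∀ η, h η ≤ specInt γp Λ (s.indicator 1) η) → ContinuousAt h ω := by
    intro h s hs h1 h2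
    exact sandwich h1 h2 (hω Λ _ (upSys_local hs))
      (fun c hc => plus_usc hmono hp (upSys_local hs) (upSys_mono hs) ω hc)
      (fun c hc => hmlsc Λ _ (upSys_local hs) (upSys_mono hs) ω c hc)
  have hle1 : ∀ s ∈ upSys (Site d) Ω₀, ∀ η,
      specInt γm Λ (s.indicator 1) η ≤ specInt γ Λ (s.indicator 1) η :=
    fun s hs η => hmle Λ _ (upSys_local hs) (upSys_mono hs) η
  have hle2 : ∀ s ∈ upSys (Site d) Ω₀, ∀ η,
      specInt γ Λ (s.indicator 1) η ≤ specInt γp Λ (s.indicator 1) η :=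
    fun s hs η => plus_le hmono hp (upSys_local hs) (upSys_mono hs) η
  refine ⟨cont_of_upSys (fun s hs => ?_) hf, cont_of_upSys (fun s hs => ?_) hf,
    cont_of_upSys (fun s hs => ?_) hf⟩
  · exact key _ s hs (fun η => (hle1 s hs η).trans (hle2 s hs η)) (fun η => le_rfl)
  · exact key _ s hs (fun η => le_rfl) (fun η => (hle1 s hs η).trans (hle2 s hs η))
  · exact key _ s hs (hle1 s hs) (hle2 s hs)

end
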